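/- Classification of solutions of S(g) = −β²/2: let β ∈ ℂ with β ≠ 0, let U ⊆ ℂ be a nonempty connected open set, and let g be analytic on U with g'(z) ≠ 0 for all z ∈ U and S(g)(z) = −β²/2 for all z ∈ U. Then there exist A, B, C, D ∈ ℂ with AD − BC = 1 such that g(z)·(C·e^{βz} + D) = A·e^{βz} + B for all z ∈ U. -/

import Mathlib

/-- The Schwarzian derivative `S(g)(z) = (g''/g')'(z) - (1/2) (g''(z)/g'(z))^2`. -/
noncomputable def schwarzianDeriv (g : ℂ → ℂ) (z : ℂ) : ℂ :=
  deriv (fun w => deriv (deriv g) w / deriv g w) z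
    - (1 / 2) * (deriv (deriv g) z / deriv g z) ^ 2

/-- Two solutions of `y' = (h' / h) y / 2` on a connected open set have product proportional
to `h`. -/
lemma mul_eq_mul_of_hasDerivAt_half_logDeriv {U : Set ℂ} (hU : IsOpen U) (hc : IsPreconnected U)
    {h p x y : ℂ → ℂ} (h0 : ∀ z ∈ U, h z ≠ 0)
    (hh : ∀ z ∈ U, HasDerivAt h (p z * h z) z)
    (hx : ∀ z ∈ U, HasDerivAt x (p z / 2 * x z) z)
    (hy : ∀ z ∈ U, HasDerivAt y (p z / 2 * y z) z)
    {z w : ℂ} (hz : z ∈ U) (hw : w ∈ U) :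
    x z * y z * h w = x w * y w * h z := by
  have key : ∀ t ∈ U, HasDerivAt (fun s => x s * y s / h s) 0 t := by
    intro t ht
    have h1 := ((hx t ht).mul (hy t ht)).div (hh t ht) (h0 t ht)
    refine h1.congr_deriv ?_
    have := h0 t ht
    simp only [Pi.mul_apply]
    field_simp
    ring
  have hconst := hU.is_const_of_deriv_eq_zero hc
    (fun t ht => (key t ht).differentiableAt.differentiableWithinAt)
    (fun t ht => (key t ht).deriv) hz hw
  exact (div_eq_div_iff (h0 z hz) (h0 w hw)).mp hconst

theorem solutions_of_constant_schwarzian (β : ℂ) (hβ : β ≠ 0)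
    (U : Set ℂ) (hU : IsOpen U) (hconn : IsConnected U)
    (g : ℂ → ℂ) (hg : ∀ z ∈ U, AnalyticAt ℂ g z) (hg' : ∀ z ∈ U, deriv g z ≠ 0)
    (hS : ∀ z ∈ U, schwarzianDeriv g z = -β ^ 2 / 2) :
    ∃ A B C D : ℂ, A * D - B * C = 1 ∧
      ∀ z ∈ U, g z * (C * Complex.exp (β * z) + D) = A * Complex.exp (β * z) + B := by
  obtain ⟨z₀, hz₀⟩ := hconn.nonempty
  set p : ℂ → ℂ := fun w => deriv (deriv g) w / deriv g w with hp
  have dg : ∀ z ∈ U, HasDerivAt g (deriv g z) z :=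
    fun z hz => (hg z hz).differentiableAt.hasDerivAt
  have dg' : ∀ z ∈ U, HasDerivAt (deriv g) (p z * deriv g z) z := by
    intro z hz
    refine (hg z hz).deriv.differentiableAt.hasDerivAt.congr_deriv ?_
    exact (div_mul_cancel₀ _ (hg' z hz)).symm
  have dp : ∀ z ∈ U, HasDerivAt p ((p z ^ 2 - β ^ 2) / 2) z := by
    intro z hz
    have h1 : DifferentiableAt ℂ p z :=
      ((hg z hz).deriv.deriv.div (hg z hz).deriv (hg' z hz)).differentiableAt
    refine h1.hasDerivAt.congr_deriv ?_
    have h2 : deriv p z - 1 / 2 * p z ^ 2 = -β ^ 2 / 2 := hS z hz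
    linear_combination h2
  have de : ∀ (k z : ℂ), HasDerivAt (fun w => Complex.exp (k * w)) (Complex.exp (k * z) * k) z :=
    fun k z => by simpa using ((hasDerivAt_id z).const_mul k).cexp
  set a : ℂ → ℂ := fun z => Complex.exp (-β / 2 * z) * (β * g z + 2 * deriv g z - g z * p z)
    with ha
  set b : ℂ → ℂ := fun z => Complex.exp (β / 2 * z) * (β * g z - 2 * deriv g z + g z * p z)
    with hb
  set c : ℂ → ℂ := fun z => Complex.exp (-β / 2 * z) * (β - p z) with hc
  set d : ℂ → ℂ := fun z => Complex.exp (β / 2 * z) * (β + p z) with hd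
  have da : ∀ z ∈ U, HasDerivAt a (p z / 2 * a z) z := fun z hz =>
    ((de (-β / 2) z).mul ((((dg z hz).const_mul β).add ((dg' z hz).const_mul 2)).sub
      ((dg z hz).mul (dp z hz)))).congr_deriv (by simp [ha]; ring)
  have db : ∀ z ∈ U, HasDerivAt b (p z / 2 * b z) z := fun z hz =>
    ((de (β / 2) z).mul ((((dg z hz).const_mul β).sub ((dg' z hz).const_mul 2)).add
      ((dg z hz).mul (dp z hz)))).congr_deriv (by simp [hb]; ring)
  have dc : ∀ z ∈ U, HasDerivAt c (p z / 2 * c z) z := fun z hz =>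
    ((de (-β / 2) z).mul ((dp z hz).const_sub β)).congr_deriv (by simp [hc]; ring)
  have dd : ∀ z ∈ U, HasDerivAt d (p z / 2 * d z) z := fun z hz =>
    ((de (β / 2) z).mul ((dp z hz).const_add β)).congr_deriv (by simp [hd]; ring)
  have hexp : ∀ z, Complex.exp (-β / 2 * z) * Complex.exp (β / 2 * z) = 1 := fun z => by
    rw [← Complex.exp_add, ← Complex.exp_zero]; ring_nf
  have hexp' : ∀ z, Complex.exp (β * z) = Complex.exp (β / 2 * z) * Complex.exp (β / 2 * z) :=
    fun z => by rw [← Complex.exp_add]; ring_nf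
  have hdet : a z₀ * d z₀ - b z₀ * c z₀ = 4 * β * deriv g z₀ := by
    simp only [ha, hb, hc, hd]
    linear_combination (4 * β * deriv g z₀) * hexp z₀
  have hrel : ∀ z, g z * (c z * Complex.exp (β * z) + d z) = a z * Complex.exp (β * z) + b z := by
    intro z
    simp only [ha, hb, hc, hd, hexp']
    linear_combination (-2 * deriv g z) * Complex.exp (β / 2 * z) * hexp z
  have h4 : 4 * β * deriv g z₀ ≠ 0 := mul_ne_zero (mul_ne_zero (by norm_num) hβ) (hg' z₀ hz₀)
  have hrel₀ : ∀ z ∈ U,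
      g z * (c z₀ * Complex.exp (β * z) + d z₀) = a z₀ * Complex.exp (β * z) + b z₀ := by
    intro z hz
    have hmul : ∀ y : ℂ → ℂ, (∀ z ∈ U, HasDerivAt y (p z / 2 * y z) z) →
        y z₀ * (g z * (c z₀ * Complex.exp (β * z) + d z₀)
          - (a z₀ * Complex.exp (β * z) + b z₀)) = 0 := by
      intro y dy
      have prop := fun x dx => mul_eq_mul_of_hasDerivAt_half_logDeriv hU hconn.isPreconnected
        hg' dg' (x := x) dx dy hz₀ hz
      refine (mul_eq_zero.mp ?_).resolve_right (hg' z hz)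
      linear_combination g z * Complex.exp (β * z) * prop c dc + g z * prop d dd
        - Complex.exp (β * z) * prop a da - prop b db + y z * deriv g z₀ * hrel z
    rw [← sub_eq_zero]
    refine (mul_eq_zero.mp ?_).resolve_left h4
    rw [← hdet]
    linear_combination a z₀ * hmul d dd - b z₀ * hmul c dc
  obtain ⟨s, hs⟩ := IsAlgClosed.exists_pow_nat_eq (4 * β * deriv g z₀)⁻¹ two_pos
  refine ⟨s * a z₀, s * b z₀, s * c z₀, s * d z₀, ?_, fun z hz => ?_⟩
  · calc _ = s ^ 2 * (a z₀ * d z₀ - b z₀ * c z₀) := by ring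
      _ = 1 := by rw [hs, hdet, inv_mul_cancel₀ h4]
  · linear_combination s * hrel₀ z hz
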